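/- arXiv:2212.14580 — 2 statements merged into one kernel-verified Lean document; each statement's English description precedes it below -/
import Mathlib

section
/- (Deterministic core of Lemma 4.1: prediction-error bound for the ℓ¹-constrained synthetic control estimator.) Let X be a real T×n matrix, let w ∈ ℝⁿ satisfy ‖w‖₁ ≤ K for a constant K > 0, let ε ∈ ℝᵀ, and set Y := X w + ε. Suppose ŵ ∈ ℝⁿ satisfies ‖ŵ‖₁ ≤ K and ‖Y − X ŵ‖₂² ≤ ‖Y − X v‖₂² for every v ∈ ℝⁿ with ‖v‖₁ ≤ K. Then ‖X(ŵ − w)‖₂² ≤ 4 K · max_{1 ≤ j ≤ n} |Σ_{t=1}^{T} X_{t j} ε_t|, i.e. ‖X(ŵ − w)‖₂² ≤ 4 K ‖Xᵀ ε‖_∞. -/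
open Finset

/-- Hölder's inequality between the `ℓ¹`-norm and the sup norm. -/
theorem dotProduct_le_norm_mul_sum_abs {ι : Type*} [Fintype ι] (u v : ι → ℝ) :
    u ⬝ᵥ v ≤ ‖u‖ * ∑ j, |v j| := by
  rw [dotProduct, Finset.mul_sum]
  refine Finset.sum_le_sum fun j _ => (le_abs_self _).trans ?_
  rw [abs_mul]
  exact mul_le_mul_of_nonneg_right (norm_le_pi_norm u j) (abs_nonneg _)

/-- Deterministic core of Lemma 4.1: prediction-error bound for the
ℓ¹-constrained synthetic control estimator:
`‖X(ŵ - w)‖₂² ≤ 4 K ‖Xᵀ ε‖_∞`.  Here the `∞`-norm of `Xᵀ ε : Fin n → ℝ` is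
the sup norm coming from the `Pi` normed-group instance. -/
theorem sc_prediction_error_bound {T n : ℕ} (X : Matrix (Fin T) (Fin n) ℝ)
    (K : ℝ) (hK : 0 < K) (w wHat : Fin n → ℝ) (ε : Fin T → ℝ) (Y : Fin T → ℝ)
    (hY : Y = X.mulVec w + ε)
    (hw : ∑ j, |w j| ≤ K) (hwHat : ∑ j, |wHat j| ≤ K)
    (hfit : ∀ v : Fin n → ℝ, ∑ j, |v j| ≤ K →
      ∑ t, (Y t - X.mulVec wHat t) ^ 2 ≤ ∑ t, (Y t - X.mulVec v t) ^ 2) :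
    ∑ t, (X.mulVec (wHat - w) t) ^ 2 ≤ 4 * K * ‖X.transpose.mulVec ε‖ := by
  have basic : ∑ t, (X.mulVec (wHat - w) t) ^ 2 ≤ 2 * (ε ⬝ᵥ X.mulVec (wHat - w)) := by
    have h := hfit w hw
    rw [← sub_nonneg, ← Finset.sum_sub_distrib] at h
    rw [← sub_nonneg, dotProduct, Finset.mul_sum, ← Finset.sum_sub_distrib]
    refine h.trans_eq (Finset.sum_congr rfl fun t _ => ?_)
    simp only [hY, Matrix.mulVec_sub, Pi.add_apply, Pi.sub_apply]
    ring
  have transfer : ε ⬝ᵥ X.mulVec (wHat - w) = X.transpose.mulVec ε ⬝ᵥ (wHat - w) := by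
    rw [Matrix.dotProduct_mulVec, Matrix.mulVec_transpose]
  have diam : ∑ j, |(wHat - w) j| ≤ 2 * K := by
    calc ∑ j, |(wHat - w) j| ≤ ∑ j, (|wHat j| + |w j|) :=
          Finset.sum_le_sum fun j _ => abs_sub (wHat j) (w j)
      _ ≤ 2 * K := by rw [Finset.sum_add_distrib]; linarith
  have holder := dotProduct_le_norm_mul_sum_abs (X.transpose.mulVec ε) (wHat - w)
  have bound := mul_le_mul_of_nonneg_left diam (norm_nonneg (X.transpose.mulVec ε))
  linarith
end

section
/- (Conditional form of Lemma 4.1: convergence rate for the synthetic control outcomes on the high-probability event.) Let X be a real T×n matrix, w ∈ ℝⁿ with ‖w‖₁ ≤ K (K > 0), ε ∈ ℝᵀ, and Y := X w + ε. Suppose ŵ ∈ ℝⁿ satisfies ‖ŵ‖₁ ≤ K and ‖Y − X ŵ‖₂² ≤ ‖Y − X v‖₂² for every v ∈ ℝⁿ with ‖v‖₁ ≤ K. If moreover max_{1 ≤ j ≤ n} |Σ_{t=1}^{T} X_{t j} ε_t| ≤ κ c₃ [log(max(T, n))]^{(1+τ)/(2τ)} √T for constants κ, c₃, τ > 0, then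 the time-averaged squared prediction error satisfies (1/T) Σ_{t=1}^{T} ((X ŵ)_t − (X w)_t)² ≤ 4 K κ c₃ [log(max(T, n))]^{(1+τ)/(2τ)} / √T. -/
open Finset

/-- Hölder's inequality for the pairing of `X.mulVec d` with `ε`. -/
lemma sum_mulVec_mul_le {ι κ : Type*} [Fintype ι] [Fintype κ] (X : Matrix ι κ ℝ)
    (d : κ → ℝ) (ε : ι → ℝ) {M : ℝ} (hM : ∀ j, |∑ t, X t j * ε t| ≤ M) :
    ∑ t, X.mulVec d t * ε t ≤ (∑ j, |d j|) * M := by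
  have hswap : ∑ t, X.mulVec d t * ε t = ∑ j, d j * ∑ t, X t j * ε t := by
    simp only [Matrix.mulVec, dotProduct, sum_mul, mul_sum]
    rw [sum_comm]
    exact sum_congr rfl fun _ _ => sum_congr rfl fun _ _ => by ring
  rw [hswap, sum_mul]
  refine sum_le_sum fun j _ => (le_abs_self _).trans ?_
  rw [abs_mul]
  exact mul_le_mul_of_nonneg_left (hM j) (abs_nonneg _)

/-- The basic inequality of least squares: if `a` fits `b + ε` at least as well as `b` does, then
the squared distance from `a` to `b` is at most twice the noise term. -/
lemma sum_sub_sq_le_two_mul_sum {ι : Type*} [Fintype ι] (a b ε : ι → ℝ)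
    (h : ∑ t, (b t + ε t - a t) ^ 2 ≤ ∑ t, (b t + ε t - b t) ^ 2) :
    ∑ t, (a t - b t) ^ 2 ≤ 2 * ∑ t, (a t - b t) * ε t := by
  have hexpand : ∑ t, (b t + ε t - a t) ^ 2 - ∑ t, (b t + ε t - b t) ^ 2 =
      ∑ t, (a t - b t) ^ 2 - 2 * ∑ t, (a t - b t) * ε t := by
    rw [mul_sum, ← sum_sub_distrib, ← sum_sub_distrib]
    exact sum_congr rfl fun _ _ => by ring
  linarith

/-- Conditional form of Lemma 4.1: on the high-probability event
`max_j |Σ_t X_{t j} ε_t| ≤ κ c₃ [log(max(T,n))]^{(1+τ)/(2τ)} √T`,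
the time-averaged squared prediction error of the ℓ¹-constrained synthetic
control estimator is at most `4 K κ c₃ [log(max(T,n))]^{(1+τ)/(2τ)} / √T`. -/
theorem sc_rate_on_event {T n : ℕ} (X : Matrix (Fin T) (Fin n) ℝ)
    (K κ c₃ τ : ℝ) (hK : 0 < K) (hκ : 0 < κ) (hc₃ : 0 < c₃) (hτ : 0 < τ)
    (w wHat : Fin n → ℝ) (ε : Fin T → ℝ) (Y : Fin T → ℝ)
    (hY : Y = X.mulVec w + ε)
    (hw : ∑ j, |w j| ≤ K) (hwHat : ∑ j, |wHat j| ≤ K)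
    (hfit : ∀ v : Fin n → ℝ, ∑ j, |v j| ≤ K →
      ∑ t, (Y t - X.mulVec wHat t) ^ 2 ≤ ∑ t, (Y t - X.mulVec v t) ^ 2)
    (hevent : ∀ j : Fin n, |∑ t, X t j * ε t| ≤
      κ * c₃ * (Real.log (max (T : ℝ) (n : ℝ))) ^ ((1 + τ) / (2 * τ)) * Real.sqrt T) :
    (1 / (T : ℝ)) * ∑ t, (X.mulVec wHat t - X.mulVec w t) ^ 2 ≤
      4 * K * κ * c₃ * (Real.log (max (T : ℝ) (n : ℝ))) ^ ((1 + τ) / (2 * τ)) /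
        Real.sqrt T := by
  rcases Nat.eq_zero_or_pos T with rfl | hT
  · simp
  have hT1 : (1 : ℝ) ≤ T := by exact_mod_cast hT
  have hsqrt : 0 < Real.sqrt T := Real.sqrt_pos.mpr (by linarith)
  have hlog : 0 ≤ Real.log (max (T : ℝ) (n : ℝ)) ^ ((1 + τ) / (2 * τ)) :=
    Real.rpow_nonneg (Real.log_nonneg (le_max_of_le_left hT1)) _
  set L := Real.log (max (T : ℝ) (n : ℝ)) ^ ((1 + τ) / (2 * τ))
  have hd : ∑ j, |(wHat - w) j| ≤ 2 * K := calc
    ∑ j, |(wHat - w) j| ≤ ∑ j, (|wHat j| + |w j|) := sum_le_sum fun j _ => abs_sub _ _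
    _ ≤ 2 * K := by rw [sum_add_distrib]; linarith
  have hnoise := (sum_mulVec_mul_le X (wHat - w) ε hevent).trans
    (mul_le_mul_of_nonneg_right hd (by positivity))
  simp only [Matrix.mulVec_sub, Pi.sub_apply] at hnoise
  have hbasic := sum_sub_sq_le_two_mul_sum (X.mulVec wHat) (X.mulVec w) ε
    (by simpa only [hY, Pi.add_apply] using hfit w hw)
  rw [le_div_iff₀ hsqrt, one_div, mul_assoc, inv_mul_le_iff₀ (by linarith)]
  calc (∑ t, (X.mulVec wHat t - X.mulVec w t) ^ 2) * Real.sqrt T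
      ≤ 2 * (2 * K * (κ * c₃ * L * Real.sqrt T)) * Real.sqrt T := by gcongr; linarith
    _ = 4 * K * κ * c₃ * L * (Real.sqrt T * Real.sqrt T) := by ring
    _ = T * (4 * K * κ * c₃ * L) := by rw [Real.mul_self_sqrt (by linarith)]; ring
end
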